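/- arXiv:2303.09125 — 3 statements merged into one kernel-verified Lean document; each statement's English description precedes it below -/
import Mathlib

section
/- Let R̃ = ℤ_p[t]/(P(t)) with P monic, G a finite R̃-module with p^{k−1}G = 0, R = (ℤ/p^kℤ)[t]/(P(t)), and let F be the field 𝔽_p[t]/(P̄_j(t)) where P̄_j is an irreducible factor of P mod p. Then |Ext¹_{R̃}(G, F)| = |Ext¹_R(G, F)|. -/
open Polynomial

namespace Stmt14
open CategoryTheory

/-- Restriction of linear maps to the kernel of `π`. -/
def resHom {A X G : Type} (M : Type) [CommRing A] [AddCommGroup X] [Module A X]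
    [AddCommGroup G] [Module A G] [AddCommGroup M] [Module A M] (π : X →ₗ[A] G) :
    (X →ₗ[A] M) →+ (LinearMap.ker π →ₗ[A] M) where
  toFun φ := φ.comp (LinearMap.ker π).subtype
  map_zero' := by ext; simp
  map_add' _ _ := by ext; simp

section indep
variable {A X Y G M : Type} [CommRing A] [AddCommGroup X] [Module A X]
    [AddCommGroup Y] [Module A Y]
    [AddCommGroup G] [Module A G] [AddCommGroup M] [Module A M]

/-- Pullback along a map over `G`. -/
def pull (π : X →ₗ[A] G) (π' : Y →ₗ[A] G) (f : X →ₗ[A] Y) (hf : ∀ x, π' (f x) = π x) :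
    (LinearMap.ker π' →ₗ[A] M) →+ (LinearMap.ker π →ₗ[A] M) where
  toFun φ := φ.comp (f.restrict (p := LinearMap.ker π) (q := LinearMap.ker π')
    (fun x hx => by simpa [hf] using hx))
  map_zero' := by ext; simp
  map_add' _ _ := by ext; simp

/-- Pullback on quotients. -/
def pullQ (π : X →ₗ[A] G) (π' : Y →ₗ[A] G) (f : X →ₗ[A] Y) (hf : ∀ x, π' (f x) = π x) :
    ((LinearMap.ker π' →ₗ[A] M) ⧸ (resHom M π').range) →+
      ((LinearMap.ker π →ₗ[A] M) ⧸ (resHom M π).range) :=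
  QuotientAddGroup.map _ _ (pull π π' f hf) (by
    rintro _ ⟨ψ, rfl⟩
    exact ⟨ψ.comp f, by ext; simp [resHom, pull]⟩)

lemma pullQ_pullQ (π : X →ₗ[A] G) (π' : Y →ₗ[A] G) (f : X →ₗ[A] Y) (hf : ∀ x, π' (f x) = π x)
    (g : Y →ₗ[A] X) (hg : ∀ x, π (g x) = π' x)
    (z : (LinearMap.ker π →ₗ[A] M) ⧸ (resHom M π).range) :
    pullQ π π' f hf (pullQ π' π g hg z) = z := by
  induction z using QuotientAddGroup.induction_on with
  | H φ =>
    refine (QuotientAddGroup.eq (s := (resHom M π).range)).2 ?_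
    refine ⟨φ.comp ((LinearMap.id - g.comp f).codRestrict (LinearMap.ker π) (fun x => ?_)), ?_⟩
    · refine LinearMap.ext fun x => ?_
      change φ _ = - φ _ + φ x
      rw [← map_neg, ← map_add]
      refine congrArg φ (Subtype.ext ?_)
      exact sub_eq_neg_add _ _
    · -- the difference lands in the kernel
      rw [LinearMap.mem_ker, LinearMap.sub_apply, map_sub, LinearMap.comp_apply, hg, hf]
      exact sub_self _

lemma card_indep (π : X →ₗ[A] G) (π' : Y →ₗ[A] G) [Module.Projective A X] [Module.Projective A Y]
    (h : Function.Surjective π) (h' : Function.Surjective π') :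
    Nat.card ((LinearMap.ker π →ₗ[A] M) ⧸ (resHom M π).range) =
    Nat.card ((LinearMap.ker π' →ₗ[A] M) ⧸ (resHom M π').range) := by
  obtain ⟨f, hf⟩ := Module.projective_lifting_property π' π h'
  obtain ⟨g, hg⟩ := Module.projective_lifting_property π π' h
  have hf := fun x => LinearMap.congr_fun hf x
  have hg := fun x => LinearMap.congr_fun hg x
  exact Nat.card_congr ⟨pullQ _ _ g hg, pullQ _ _ f hf, pullQ_pullQ _ _ _ _ _ _,
    pullQ_pullQ _ _ _ _ _ _⟩

end indep

lemma card_homology {A H : Type} [CommRing A] [AddCommGroup H] (S : ShortComplex (ModuleCat.{0} A))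
    (L : H →+ S.X₂) (hL : Function.Injective L)
    (hk : ∀ x, S.g.hom x = 0 ↔ ∃ h, L h = x)
    (B : AddSubgroup H) (hB : ∀ h, h ∈ B ↔ ∃ y, S.f.hom y = L h) :
    Nat.card S.homology = Nat.card (H ⧸ B) := by
  let e : H ≃ LinearMap.ker S.g.hom := Equiv.ofBijective (fun h => ⟨L h, (hk _).2 ⟨h, rfl⟩⟩)
    ⟨fun a b h => hL (congrArg Subtype.val h), fun ⟨x, hx⟩ => by
      obtain ⟨h, rfl⟩ := (hk x).1 hx
      exact ⟨h, rfl⟩⟩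
  rw [Nat.card_congr S.moduleCatHomologyIso.toLinearEquiv.toEquiv]
  symm
  refine Nat.card_congr (Quotient.congr e ?_)
  intro a b
  rw [QuotientAddGroup.leftRel_apply, Submodule.quotientRel_def, hB]
  constructor
  · rintro ⟨y, hy⟩
    refine ⟨-y, ?_⟩
    ext
    have : S.f.hom (-y) = L a - L b := by rw [map_neg, hy]; simp [sub_eq_add_neg, add_comm]
    exact this
  · rintro ⟨y, hy⟩
    refine ⟨-y, ?_⟩
    have : S.f.hom y = L a - L b := congrArg Subtype.val hy
    rw [map_neg, this]; simp [sub_eq_add_neg, add_comm]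

lemma card_ext {A G M X : Type} [CommRing A] [AddCommGroup G] [Module A G] [AddCommGroup M]
    [Module A M] [AddCommGroup X] [Module A X] [Module.Projective A X] (π : X →ₗ[A] G)
    (hπ : Function.Surjective π) :
    Nat.card ↥(((_root_.Ext A (ModuleCat.{0} A) 1).obj
        (Opposite.op (ModuleCat.of A G))).obj (ModuleCat.of A M)) =
    Nat.card ((LinearMap.ker π →ₗ[A] M) ⧸ (resHom M π).range) := by
  let P := ProjectiveResolution.of (ModuleCat.of A G)
  let M' := ModuleCat.of A M
  rw [Nat.card_congr (P.isoExt (R := A) 1 M').toLinearEquiv.toEquiv]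
  let K := P.complex.linearYonedaObj A M'
  let e := (ShortComplex.homologyMapIso (K.isoSc' 0 1 2 (by simp) (by simp)))
  have : Nat.card (K.homology 1) = Nat.card (K.sc' 0 1 2).homology :=
    Nat.card_congr e.toLinearEquiv.toEquiv
  rw [this]
  let ρ : P.complex.X 0 →ₗ[A] G := (P.π.f 0).hom
  have hρ : Function.Surjective ρ := (ModuleCat.epi_iff_surjective _).1 inferInstance
  have : Module.Projective A (P.complex.X 0) := by
    rw [IsProjective.iff_projective]
    exact P.projective 0
  rw [← card_indep ρ π hρ hπ]
  let d1 : P.complex.X 1 →ₗ[A] P.complex.X 0 := (P.complex.d 1 0).hom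
  let d2 : P.complex.X 2 →ₗ[A] P.complex.X 1 := (P.complex.d 2 1).hom
  have h0 : ∀ x, ρ (d1 x) = 0 := fun x =>
    ConcreteCategory.congr_hom P.complex_d_comp_π_f_zero x
  have h1 : ∀ x, d1 (d2 x) = 0 := fun x =>
    ConcreteCategory.congr_hom (P.complex.d_comp_d 2 1 0) x
  have e0 : ∀ x, ρ x = 0 → ∃ y, d1 y = x := by
    have := P.exact₀
    exact (ShortComplex.moduleCat_exact_iff _).1 this
  have e1 : ∀ x, d1 x = 0 → ∃ y, d2 y = x := by
    have := P.exact_succ 0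
    exact (ShortComplex.moduleCat_exact_iff _).1 this
  let D : P.complex.X 1 →ₗ[A] LinearMap.ker ρ := d1.codRestrict _ h0
  have hD : Function.Surjective D := by
    rintro ⟨x, hx⟩
    obtain ⟨y, rfl⟩ := e0 x hx
    exact ⟨y, rfl⟩
  let L : (LinearMap.ker ρ →ₗ[A] M) →+ (K.sc' 0 1 2).X₂ :=
    { toFun := fun φ => (ModuleCat.ofHom (φ.comp D) : P.complex.X 1 ⟶ M')
      map_zero' := rfl
      map_add' := fun _ _ => rfl }
  refine card_homology (K.sc' 0 1 2) L ?_ ?_ _ ?_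
  · intro φ ψ h
    have h' : φ.comp D = ψ.comp D := congrArg ModuleCat.Hom.hom h
    ext x
    obtain ⟨y, rfl⟩ := hD x
    exact LinearMap.congr_fun h' y
  · intro (φ : P.complex.X 1 ⟶ M')
    constructor
    · intro h
      have h : P.complex.d 2 1 ≫ φ = 0 := h
      have hφ : LinearMap.ker D ≤ LinearMap.ker φ.hom := by
        intro x hx
        obtain ⟨y, rfl⟩ := e1 x (congrArg Subtype.val hx)
        exact ConcreteCategory.congr_hom h y
      refine ⟨(LinearMap.ker D).liftQ φ.hom hφ ∘ₗ
        (D.quotKerEquivOfSurjective hD).symm.toLinearMap, ?_⟩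
      change ModuleCat.ofHom _ = φ
      ext x
      have : (D.quotKerEquivOfSurjective hD).symm (D x) = Submodule.Quotient.mk x := by
        rw [LinearEquiv.symm_apply_eq]; rfl
      simp [this]
    · rintro ⟨ψ, rfl⟩
      change P.complex.d 2 1 ≫ ModuleCat.ofHom (ψ.comp D) = 0
      ext x
      have : D (d2 x) = 0 := Subtype.ext (h1 x)
      change ψ (D (d2 x)) = 0
      rw [this, map_zero]
  · intro φ
    constructor
    · rintro ⟨ψ, rfl⟩
      exact ⟨(ModuleCat.ofHom ψ : P.complex.X 0 ⟶ M'), rfl⟩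
    · rintro ⟨(ψ : P.complex.X 0 ⟶ M'), h⟩
      have h : P.complex.d 1 0 ≫ ψ = ModuleCat.ofHom (φ.comp D) := h
      refine ⟨ψ.hom, ?_⟩
      ext x
      obtain ⟨y, rfl⟩ := hD x
      exact ConcreteCategory.congr_hom h y

lemma descend {A B U V M : Type} [CommRing A] [CommRing B] (σ : A →+* B)
    (hσ : Function.Surjective σ) [AddCommGroup U] [Module A U] [AddCommGroup V] [Module B V]
    [AddCommGroup M] [Module A M] [Module B M] (hM : ∀ (a : A) (m : M), σ a • m = a • m)
    (f : U →ₛₗ[σ] V) (hf : Function.Surjective f) (φ : U →ₗ[A] M)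
    (h : ∀ x, f x = 0 → φ x = 0) : ∃ ψ : V →ₗ[B] M, ∀ x, ψ (f x) = φ x := by
  have key : ∀ x y, f x = f y → φ x = φ y := fun x y hxy => by
    rw [← sub_eq_zero, ← map_sub]; exact h _ (by rw [map_sub, hxy, sub_self])
  choose s hs using hf
  refine ⟨{ toFun := fun v => φ (s v), map_add' := fun v w => ?_, map_smul' := fun b v => ?_ },
    fun x => key _ _ (hs _)⟩
  · rw [← map_add]; exact key _ _ (by simp [hs])
  · obtain ⟨a, rfl⟩ := hσ b
    rw [RingHom.id_apply, hM, ← map_smul]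
    exact key _ _ (by simp [hs])

lemma card_change {A B G M : Type} [CommRing A] [CommRing B] (σ : A →+* B)
    (hσ : Function.Surjective σ) [AddCommGroup G] [Module A G] [Module B G]
    [AddCommGroup M] [Module A M] [Module B M] (hM : ∀ (a : A) (m : M), σ a • m = a • m)
    (hG : ∀ (a : A) (m : G), σ a • m = a • m) (u v : A) (hu : ∀ m : M, u • m = 0)
    (hv : ∀ g : G, v • g = 0) (hker : ∀ a, σ a = 0 → ∃ b, a = u * (v * b)) :
    Nat.card ((LinearMap.ker (Finsupp.linearCombination A (id : G → G)) →ₗ[A] M) ⧸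
      (resHom M (Finsupp.linearCombination A (id : G → G))).range) =
    Nat.card ((LinearMap.ker (Finsupp.linearCombination B (id : G → G)) →ₗ[B] M) ⧸
      (resHom M (Finsupp.linearCombination B (id : G → G))).range) := by
  set πA := Finsupp.linearCombination A (id : G → G) with hA
  set πB := Finsupp.linearCombination B (id : G → G) with hB
  let f : (G →₀ A) →ₛₗ[σ] (G →₀ B) :=
    { toFun := Finsupp.mapRange σ (map_zero σ)
      map_add' := fun x y => by ext; simp
      map_smul' := fun a x => by ext; simp }
  have hf : Function.Surjective f := Finsupp.mapRange_surjective σ (map_zero σ) hσ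
  have hπ : ∀ x, πB (f x) = πA x := by
    intro x
    simp only [hA, hB, Finsupp.linearCombination_apply]
    change (Finsupp.mapRange σ (map_zero σ) x).sum _ = _
    rw [Finsupp.sum_mapRange_index (by simp)]
    simp [hG]
  have hk : ∀ x, f x = 0 → ∃ y, πA y = 0 ∧ x = u • y := by
    intro x hx
    have : ∀ g, ∃ b, x g = u * (v * b) := fun g => hker _ (DFunLike.congr_fun hx g)
    choose b hb using this
    classical
    let y : G →₀ A := Finsupp.onFinset x.support (fun g => if x g = 0 then 0 else b g) (by
      intro g; simp; tauto)
    refine ⟨v • y, ?_, ?_⟩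
    · rw [map_smul, hv]
    · ext g
      by_cases h : x g = 0
      · simp [y, h]
      · simp only [y, Finsupp.smul_apply, Finsupp.onFinset_apply, if_neg h, smul_eq_mul]
        exact hb g
  let fN : LinearMap.ker πA →ₛₗ[σ] LinearMap.ker πB :=
    { toFun := fun x => ⟨f x, by rw [LinearMap.mem_ker, hπ]; exact x.2⟩
      map_add' := fun x y => Subtype.ext (map_add f _ _)
      map_smul' := fun a x => Subtype.ext (map_smulₛₗ f _ _) }
  have hfN : Function.Surjective fN := by
    rintro ⟨x, hx⟩
    obtain ⟨y, rfl⟩ := hf x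
    exact ⟨⟨y, by rw [LinearMap.mem_ker, ← hπ]; exact hx⟩, rfl⟩
  let T : (LinearMap.ker πB →ₗ[B] M) →+ (LinearMap.ker πA →ₗ[A] M) :=
    { toFun := fun ψ =>
        { toFun := fun x => ψ (fN x)
          map_add' := fun x y => by simp
          map_smul' := fun a x => by simp [hM] }
      map_zero' := by ext; simp
      map_add' := fun _ _ => by ext; simp }
  have hT : Function.Bijective T := by
    constructor
    · intro ψ ψ' h
      ext x
      obtain ⟨y, rfl⟩ := hfN x
      exact LinearMap.congr_fun h y
    · intro φ
      have h0 : ∀ x, fN x = 0 → φ x = 0 := by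
        intro x hx
        obtain ⟨y, hy, hxy⟩ := hk x (congrArg Subtype.val hx)
        have : x = u • (⟨y, hy⟩ : LinearMap.ker πA) := Subtype.ext hxy
        rw [this, map_smul, hu]
      obtain ⟨ψ, hψ⟩ := descend (U := LinearMap.ker πA) (V := LinearMap.ker πB) σ hσ hM fN hfN φ h0
      exact ⟨ψ, LinearMap.ext hψ⟩
  symm
  refine Nat.card_congr (QuotientAddGroup.congr _ _ (AddEquiv.ofBijective T hT) ?_).toEquiv
  ext φ
  constructor
  · rintro ⟨_, ⟨ψ, rfl⟩, rfl⟩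
    refine ⟨{ toFun := fun x => ψ (f x)
              map_add' := fun x y => by simp
              map_smul' := fun a x => by rw [map_smulₛₗ, map_smul, hM]; rfl }, ?_⟩
    ext x
    rfl
  · rintro ⟨ψ, rfl⟩
    obtain ⟨ψ', hψ⟩ := descend σ hσ hM f hf ψ (by
        intro x hx
        obtain ⟨y, hy, hxy⟩ := hk x hx
        rw [hxy, map_smul, hu])
    refine ⟨resHom M πB ψ', ⟨ψ', rfl⟩, ?_⟩
    ext x
    exact hψ x

lemma castHom_toZModPow (p k : ℕ) [Fact p.Prime] (h : p ∣ p ^ k) (x : ℤ_[p]) :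
    ZMod.castHom h (ZMod p) (PadicInt.toZModPow k x) = PadicInt.toZMod x := by
  obtain ⟨n, -, hn⟩ := PadicInt.exists_mem_range x
  rw [PadicInt.maximalIdeal_eq_span_p, Ideal.mem_span_singleton] at hn
  obtain ⟨y, hy⟩ := hn
  obtain rfl : x = n + p * y := by rw [← hy]; ring
  rw [map_add, map_mul, map_natCast, map_natCast, map_add, map_mul, map_natCast, map_natCast,
    map_add, map_mul, map_natCast, map_natCast]
  simp

end Stmt14




/-- Let `R̃ = ℤ_p[t]/(P)` with `P` monic, `G` a finite `R̃`-module with `p^(k-1)·G = 0`,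
`R = (ℤ/p^kℤ)[t]/(P)`, and `F = 𝔽_p[t]/(P̄_j)` for an irreducible factor `P̄_j` of
`P mod p`. Then `|Ext¹_{R̃}(G, F)| = |Ext¹_R(G, F)|`. -/
theorem stmt_14 (p k : ℕ) [Fact p.Prime] (hk : 1 ≤ k)
    (P : Polynomial ℤ_[p]) (hP : P.Monic)
    (Pj : Polynomial (ZMod p)) (hPj : Irreducible Pj) (hPjmonic : Pj.Monic)
    (hPjdvd : Pj ∣ P.map (PadicInt.toZMod (p := p)))
    (G : Type) [AddCommGroup G] [Finite G]
    [Module (Polynomial ℤ_[p] ⧸ Ideal.span {P}) G]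
    [Module (Polynomial (ZMod (p ^ k)) ⧸ Ideal.span {P.map (PadicInt.toZModPow k)}) G]
    (hGcompat : ∀ (q : Polynomial ℤ_[p]) (g : G),
      (Ideal.Quotient.mk (Ideal.span {P}) q) • g =
        (Ideal.Quotient.mk (Ideal.span {P.map (PadicInt.toZModPow k)})
          (q.map (PadicInt.toZModPow k))) • g)
    (hGk : ∀ g : G, (p ^ (k - 1)) • g = 0)
    [Module (Polynomial ℤ_[p] ⧸ Ideal.span {P}) (Polynomial (ZMod p) ⧸ Ideal.span {Pj})]
    [Module (Polynomial (ZMod (p ^ k)) ⧸ Ideal.span {P.map (PadicInt.toZModPow k)})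
      (Polynomial (ZMod p) ⧸ Ideal.span {Pj})]
    (hFcompat₁ : ∀ (q : Polynomial ℤ_[p]) (x : Polynomial (ZMod p) ⧸ Ideal.span {Pj}),
      (Ideal.Quotient.mk (Ideal.span {P}) q) • x =
        (Ideal.Quotient.mk (Ideal.span {Pj}) (q.map (PadicInt.toZMod (p := p)))) * x)
    (hFcompat₂ : ∀ (q : Polynomial (ZMod (p ^ k)))
        (x : Polynomial (ZMod p) ⧸ Ideal.span {Pj}),
      (Ideal.Quotient.mk (Ideal.span {P.map (PadicInt.toZModPow k)}) q) • x =
        (Ideal.Quotient.mk (Ideal.span {Pj})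
          (q.map (ZMod.castHom (dvd_pow_self p (Nat.one_le_iff_ne_zero.mp hk))
            (ZMod p)))) * x) :
    Nat.card ↥(((_root_.Ext (Polynomial ℤ_[p] ⧸ Ideal.span {P})
          (ModuleCat.{0} (Polynomial ℤ_[p] ⧸ Ideal.span {P})) 1).obj
        (Opposite.op (ModuleCat.of _ G))).obj
          (ModuleCat.of _ (Polynomial (ZMod p) ⧸ Ideal.span {Pj})))
    = Nat.card ↥(((_root_.Ext
          (Polynomial (ZMod (p ^ k)) ⧸ Ideal.span {P.map (PadicInt.toZModPow k)})
          (ModuleCat.{0} (Polynomial (ZMod (p ^ k)) ⧸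
            Ideal.span {P.map (PadicInt.toZModPow k)})) 1).obj
        (Opposite.op (ModuleCat.of _ G))).obj
          (ModuleCat.of _ (Polynomial (ZMod p) ⧸ Ideal.span {Pj}))) := by
  
  have hpk : p * p ^ (k - 1) = p ^ k := by rw [← pow_succ', Nat.sub_add_cancel hk]
  let τ : ℤ_[p] →+* ZMod (p ^ k) := PadicInt.toZModPow k
  have hτ : Function.Surjective τ := ZMod.ringHom_surjective τ
  have hmτ : Function.Surjective (Polynomial.mapRingHom τ) := Polynomial.map_surjective τ hτ
  let σ : (Polynomial ℤ_[p] ⧸ Ideal.span {P}) →+*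
      (Polynomial (ZMod (p ^ k)) ⧸ Ideal.span {P.map (PadicInt.toZModPow k)}) :=
    Ideal.quotientMap _ (Polynomial.mapRingHom τ) (by
      rw [Ideal.span_le, Set.singleton_subset_iff]
      exact Ideal.subset_span rfl)
  have hσq : ∀ q, σ (Ideal.Quotient.mk _ q) = Ideal.Quotient.mk _ (q.map τ) := fun q => rfl
  have hσ : Function.Surjective σ := by
    intro x
    obtain ⟨x, rfl⟩ := Ideal.Quotient.mk_surjective x
    obtain ⟨q, rfl⟩ := hmτ x
    exact ⟨Ideal.Quotient.mk _ q, rfl⟩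
  rw [Stmt14.card_ext (Finsupp.linearCombination _ (id : G → G))
      (Finsupp.linearCombination_id_surjective _ _),
    Stmt14.card_ext (Finsupp.linearCombination _ (id : G → G))
      (Finsupp.linearCombination_id_surjective _ _)]
  refine Stmt14.card_change σ hσ ?_ ?_ (p : _) ((p ^ (k - 1) : ℕ) : _) ?_ ?_ ?_
  · intro a m
    obtain ⟨q, rfl⟩ := Ideal.Quotient.mk_surjective a
    rw [hσq, hFcompat₁, hFcompat₂, Polynomial.map_map]
    congr 3
    ext x
    exact Stmt14.castHom_toZModPow p k (dvd_pow_self p (Nat.one_le_iff_ne_zero.mp hk)) x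
  · intro a m
    obtain ⟨q, rfl⟩ := Ideal.Quotient.mk_surjective a
    rw [hσq, hGcompat]
  · intro m
    have := hFcompat₁ (p : Polynomial ℤ_[p]) m
    rw [map_natCast] at this
    rw [this, Polynomial.map_natCast, ← Polynomial.C_eq_natCast, CharP.cast_eq_zero]
    simp
  · intro g
    rw [Nat.cast_smul_eq_nsmul]
    exact hGk g
  · intro a ha
    obtain ⟨q, rfl⟩ := Ideal.Quotient.mk_surjective a
    rw [hσq, Ideal.Quotient.eq_zero_iff_mem, Ideal.mem_span_singleton] at ha
    obtain ⟨r', hr⟩ := ha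
    obtain ⟨r, rfl⟩ := hmτ r'
    have hz : (q - P * r).map τ = 0 := by
      rw [Polynomial.map_sub, Polynomial.map_mul, hr]
      exact sub_self _
    have hd : C ((p : ℤ_[p]) ^ k) ∣ q - P * r := by
      rw [Polynomial.C_dvd_iff_dvd_coeff]
      intro i
      rw [← Ideal.mem_span_singleton, ← PadicInt.ker_toZModPow, RingHom.mem_ker]
      have := congrArg (fun f => Polynomial.coeff f i) hz
      rw [Polynomial.coeff_map] at this
      exact this
    obtain ⟨s, hs⟩ := hd
    refine ⟨Ideal.Quotient.mk _ s, ?_⟩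
    have h1 : q = P * r + C ((p : ℤ_[p]) ^ k) * s := by rw [← hs]; ring
    have h2 : Ideal.Quotient.mk (Ideal.span {P}) P = 0 :=
      Ideal.Quotient.eq_zero_iff_mem.2 (Ideal.subset_span rfl)
    rw [h1, map_add, map_mul, h2, zero_mul, zero_add, ← mul_assoc, ← Nat.cast_mul, hpk, map_mul]
    congr 1
    rw [← Nat.cast_pow, Polynomial.C_eq_natCast, map_natCast]
end

section
/- Let P(t) ∈ ℤ_p[t] be monic with P̄ = P̄₁^{m₁}⋯P̄_l^{m_l} mod p (P̄_j distinct irreducible of degree d_j), and let G be a finite ℤ_p[t]/(P(t))-module. Then for each j, |Ext¹_{ℤ_p[t]/(P(t))}(G, 𝔽_{p^{d_j}})| = p^{d_j·u} · |Hom_{ℤ_p[t]}(G, 𝔽_{p^{d_j}})| for some u ∈ ℤ≥0; in particular |Hom_{ℤ_p[t]}(G, 𝔽_{p^{d_j}})| ≤ |Ext¹_{ℤ_p[t]/(P(t))}(G, 𝔽_{p^{d_j}})|, with equality when m_j = 1. -/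
open Polynomial

lemma aux_modules {R : Type} [CommRing R] {X2 X1 X0 G F L : Type}
    [AddCommGroup X2] [AddCommGroup X1] [AddCommGroup X0] [AddCommGroup G] [AddCommGroup F]
    [AddCommGroup L] [Module R X2] [Module R X1] [Module R X0] [Module R G] [Module R F]
    [Module R L] [Module.Projective R X0] [Module.Projective R L]
    (d2 : X2 →ₗ[R] X1) (d1 : X1 →ₗ[R] X0) (π : X0 →ₗ[R] G) (ρ : L →ₗ[R] G)
    (h2 : Function.Exact d2 d1) (h1 : Function.Exact d1 π) (hπ : Function.Surjective π)
    (hρ : Function.Surjective ρ) :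
    ∃ Φ : (LinearMap.ker ρ →ₗ[R] F) →ₗ[R] (X1 →ₗ[R] F),
      (∀ h, Φ h ∘ₗ d2 = 0) ∧
      (∀ f : X1 →ₗ[R] F, f ∘ₗ d2 = 0 → ∃ h, ∃ g : X0 →ₗ[R] F, f = Φ h + g ∘ₗ d1) ∧
      (∀ h, (∃ g : X0 →ₗ[R] F, Φ h = g ∘ₗ d1) ↔
        ∃ g : L →ₗ[R] F, h = g ∘ₗ (LinearMap.ker ρ).subtype) := by
  obtain ⟨α, hα⟩ := Module.projective_lifting_property ρ π hρ
  obtain ⟨β, hβ⟩ := Module.projective_lifting_property π ρ hπ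
  have hα' : ∀ x, ρ (α x) = π x := fun x => LinearMap.congr_fun hα x
  have hβ' : ∀ x, π (β x) = ρ x := fun x => LinearMap.congr_fun hβ x
  have hπd : ∀ x, π (d1 x) = 0 := h1.apply_apply_eq_zero
  have hdd : ∀ x, d1 (d2 x) = 0 := h2.apply_apply_eq_zero
  let τ : X1 →ₗ[R] LinearMap.ker ρ := (α ∘ₗ d1).codRestrict _ (fun x => by
    simp [LinearMap.mem_ker, hα', hπd])
  have hτ : ∀ x, ((τ x : LinearMap.ker ρ) : L) = α (d1 x) := fun x => rfl
  let σ : L →ₗ[R] LinearMap.ker ρ := (α ∘ₗ β - LinearMap.id).codRestrict _ (fun x => by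
    simp [LinearMap.mem_ker, hα', hβ'])
  have hσ : ∀ x, ((σ x : LinearMap.ker ρ) : L) = α (β x) - x := fun x => rfl
  refine ⟨LinearMap.lcomp R F τ, ?_, ?_, ?_⟩
  · intro h
    ext x
    have : τ (d2 x) = 0 := by
      apply Subtype.ext
      simp [hτ, hdd]
    simp [this]
  · intro f hf
    have hker : LinearMap.ker d1.rangeRestrict ≤ LinearMap.ker f := by
      intro x hx
      rw [LinearMap.ker_rangeRestrict] at hx
      obtain ⟨y, rfl⟩ := (h2 x).1 hx
      exact LinearMap.congr_fun hf y
    have hex : ∀ x, x ∈ LinearMap.ker π ↔ x ∈ LinearMap.range d1 := fun x => h1 x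
    let e := d1.quotKerEquivRange
    have hker' : LinearMap.ker d1 ≤ LinearMap.ker f := by
      rwa [LinearMap.ker_rangeRestrict] at hker
    let f' : LinearMap.range d1 →ₗ[R] F := (LinearMap.ker d1).liftQ f hker' ∘ₗ e.symm.toLinearMap
    have hf' : ∀ x, f' ⟨d1 x, x, rfl⟩ = f x := by
      intro x
      have : e.symm ⟨d1 x, x, rfl⟩ = (LinearMap.ker d1).mkQ x := by
        rw [LinearEquiv.symm_apply_eq]; rfl
      simp [f', this]
    let b : LinearMap.ker ρ →ₗ[R] LinearMap.range d1 :=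
      (β ∘ₗ (LinearMap.ker ρ).subtype).codRestrict _ (fun x => by
        rw [← hex]; simp [LinearMap.mem_ker, hβ'])
    let c : X0 →ₗ[R] LinearMap.range d1 :=
      (LinearMap.id - β ∘ₗ α).codRestrict _ (fun x => by
        rw [← hex]; simp [LinearMap.mem_ker, hβ', hα'])
    refine ⟨f' ∘ₗ b, f' ∘ₗ c, ?_⟩
    ext x
    simp only [LinearMap.lcomp_apply', LinearMap.add_apply, LinearMap.comp_apply]
    rw [← map_add, ← hf']
    congr 1
    apply Subtype.ext
    simp [b, c, hτ]
  · intro h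
    constructor
    · rintro ⟨g, hg⟩
      refine ⟨g ∘ₗ β - h ∘ₗ σ, ?_⟩
      ext x
      have hx : π (β x) = 0 := by rw [hβ']; exact x.2
      obtain ⟨y, hy⟩ := (h1 _).1 hx
      have e1 : h (τ y) = g (d1 y) := LinearMap.congr_fun hg y
      simp only [LinearMap.sub_apply, LinearMap.comp_apply, Submodule.subtype_apply]
      rw [← hy, ← e1, ← map_sub]
      congr 1
      apply Subtype.ext
      simp [hτ, hσ, hy]
    · rintro ⟨g, rfl⟩
      exact ⟨g ∘ₗ α, by ext x; simp [hτ]⟩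

lemma card_add_hom {A B : Type} [AddCommGroup A] [AddCommGroup B] (f : A →+ B) :
    Nat.card A = Nat.card f.range * Nat.card f.ker := by
  rw [AddSubgroup.card_eq_card_quotient_mul_card_addSubgroup f.ker]
  congr 1
  exact Nat.card_congr (QuotientAddGroup.quotientKerEquivRange f).toEquiv

open CategoryTheory in
lemma ext_card {R : Type} [CommRing R] {G F L : Type} [AddCommGroup G] [AddCommGroup F]
    [AddCommGroup L] [Module R G] [Module R F] [Module R L] [Module.Projective R L]
    (ρ : L →ₗ[R] G) (hρ : Function.Surjective ρ) :
    Nat.card ↥(((_root_.Ext R (ModuleCat.{0} R) 1).obj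
          (Opposite.op (ModuleCat.of R G))).obj (ModuleCat.of R F)) * Nat.card (L →ₗ[R] F) =
      Nat.card (LinearMap.ker ρ →ₗ[R] F) * Nat.card (G →ₗ[R] F) := by
  let P := ProjectiveResolution.of (ModuleCat.of R G)
  let Y := ModuleCat.of R F
  have e1 := P.isoExt (R := R) 1 Y
  let S := (P.complex.linearYonedaObj R Y).sc' 0 1 2
  let e2 : (P.complex.linearYonedaObj R Y).homology 1 ≅ S.homology :=
    ShortComplex.homologyMapIso ((P.complex.linearYonedaObj R Y).isoSc' 0 1 2 (by simp) (by simp))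
  have e3 := S.moduleCatHomologyIso
  have e := (e1 ≪≫ e2 ≪≫ e3).toLinearEquiv
  rw [Nat.card_congr e.toEquiv]
  have hp0 : Module.Projective R (P.complex.X 0) :=
    (IsProjective.iff_projective _).2 (P.projective 0)
  have hs : Function.Surjective (P.π.f 0).hom :=
    (ModuleCat.epi_iff_surjective _).1 inferInstance
  have h1 : Function.Exact (P.complex.d 1 0).hom (P.π.f 0).hom := by
    have := (ShortComplex.ShortExact.moduleCat_exact_iff_function_exact _).1 P.exact₀
    exact this
  have h2 : Function.Exact (P.complex.d 2 1).hom (P.complex.d 1 0).hom := by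
    have := (ShortComplex.ShortExact.moduleCat_exact_iff_function_exact _).1 (P.exact_succ 0)
    exact this
  obtain ⟨Φ, hΦ1, hΦ2, hΦ3⟩ := aux_modules (F := F) _ _ _ ρ h2 h1 hs hρ
  have hg : ∀ f : P.complex.X 1 ⟶ Y, S.g.hom f = P.complex.d 2 1 ≫ f := fun f => rfl
  have hf : ∀ f : P.complex.X 0 ⟶ Y, S.f.hom f = P.complex.d 1 0 ≫ f := fun f => rfl
  let Φ' : (LinearMap.ker ρ →ₗ[R] F) →ₗ[R] LinearMap.ker S.g.hom :=
    { toFun := fun h => ⟨(ModuleCat.ofHom (Φ h) : P.complex.X 1 ⟶ Y), 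
        LinearMap.mem_ker.2 (ModuleCat.hom_ext (hΦ1 h))⟩
      map_add' := fun a b => Subtype.ext (ModuleCat.hom_ext (map_add Φ a b))
      map_smul' := fun a b => Subtype.ext (ModuleCat.hom_ext (map_smul Φ a b)) }
  let Ψ : (LinearMap.ker ρ →ₗ[R] F) →+ S.moduleCatLeftHomologyData.H :=
    ((LinearMap.range S.moduleCatToCycles).mkQ ∘ₗ Φ').toAddMonoidHom
  have hΨs : Function.Surjective Ψ := by
    intro y
    obtain ⟨⟨f, hf0⟩, rfl⟩ := (LinearMap.range S.moduleCatToCycles).mkQ_surjective y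
    change P.complex.X 1 ⟶ Y at f
    obtain ⟨h, g, hgh⟩ := hΦ2 f.hom (congrArg ModuleCat.Hom.hom hf0)
    refine ⟨h, ?_⟩
    refine ((Submodule.Quotient.eq _).2 ?_)
    refine ⟨(ModuleCat.ofHom (-g) : P.complex.X 0 ⟶ Y), ?_⟩
    apply Subtype.ext
    refine ModuleCat.hom_ext ?_
    change (-g) ∘ₗ _ = Φ h - f.hom
    rw [hgh]
    ext x
    simp
    rfl
  have hΨk : ∀ h, h ∈ Ψ.ker ↔ ∃ g : L →ₗ[R] F, h = g ∘ₗ (LinearMap.ker ρ).subtype := by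
    intro h
    rw [← hΦ3]
    constructor
    · intro hh
      obtain ⟨g, hg'⟩ := (Submodule.Quotient.mk_eq_zero _).1 (AddMonoidHom.mem_ker.1 hh)
      change P.complex.X 0 ⟶ Y at g
      refine ⟨g.hom, ?_⟩
      exact (congrArg ModuleCat.Hom.hom (congrArg Subtype.val hg')).symm
    · rintro ⟨g, hg'⟩
      refine AddMonoidHom.mem_ker.2 ((Submodule.Quotient.mk_eq_zero _).2 ?_)
      refine ⟨(ModuleCat.ofHom g : P.complex.X 0 ⟶ Y), ?_⟩
      apply Subtype.ext
      exact ModuleCat.hom_ext hg'.symm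
  have c1 := card_add_hom Ψ
  have c2 : Nat.card Ψ.range = Nat.card S.moduleCatLeftHomologyData.H := by
    rw [AddMonoidHom.range_eq_top.2 hΨs]
    exact Nat.card_congr AddSubgroup.topEquiv.toEquiv
  let res : (L →ₗ[R] F) →+ (LinearMap.ker ρ →ₗ[R] F) :=
    (LinearMap.lcomp R F (LinearMap.ker ρ).subtype).toAddMonoidHom
  have c3 := card_add_hom res
  have c4 : Nat.card res.range = Nat.card Ψ.ker := by
    have : res.range = Ψ.ker := by
      ext h
      rw [hΨk]
      exact ⟨fun ⟨g, hg⟩ => ⟨g, hg.symm⟩, fun ⟨g, hg⟩ => ⟨g, hg.symm⟩⟩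
    rw [this]
  have c5 : Nat.card res.ker = Nat.card (G →ₗ[R] F) := by
    symm
    refine Nat.card_congr (Equiv.ofBijective (fun g => ⟨g ∘ₗ ρ, ?_⟩) ⟨?_, ?_⟩)
    · refine AddMonoidHom.mem_ker.2 ?_
      ext x
      have : ρ x = 0 := x.2
      change g (ρ x) = 0
      simp [this]
    · intro a b hab
      have hab' := congrArg Subtype.val hab
      exact LinearMap.ext fun y => by
        obtain ⟨x, rfl⟩ := hρ y
        exact LinearMap.congr_fun hab' x
    · rintro ⟨f, hf1⟩
      have hk : LinearMap.ker ρ ≤ LinearMap.ker f := fun x hx =>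
        LinearMap.congr_fun (AddMonoidHom.mem_ker.1 hf1) ⟨x, hx⟩
      let e := ρ.quotKerEquivOfSurjective hρ
      refine ⟨(LinearMap.ker ρ).liftQ f hk ∘ₗ e.symm.toLinearMap, ?_⟩
      apply Subtype.ext
      ext x
      have : e.symm (ρ x) = (LinearMap.ker ρ).mkQ x := by
        rw [LinearEquiv.symm_apply_eq]; rfl
      simp [this]
  rw [c1, c2, c3, c4, c5]
  ring

/-- Homs to the residue field form a power of the residue field. -/
lemma card_hom_residue {R : Type} [CommRing R] (I : Ideal R) [I.IsMaximal] [Finite (R ⧸ I)]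
    (K : Type) [AddCommGroup K] [Module R K] [Module.Finite R K] :
    letI : Field (R ⧸ I) := Ideal.Quotient.field I
    Nat.card (K →ₗ[R] (R ⧸ I)) =
      Nat.card (R ⧸ I) ^ Module.finrank (R ⧸ I) (K ⧸ (I • ⊤ : Submodule R K)) ∧
    Nat.card (K ⧸ (I • ⊤ : Submodule R K)) = 
      Nat.card (R ⧸ I) ^ Module.finrank (R ⧸ I) (K ⧸ (I • ⊤ : Submodule R K)) := by
  letI : Field (R ⧸ I) := Ideal.Quotient.field I
  have : Module.Finite (R ⧸ I) (K ⧸ (I • ⊤ : Submodule R K)) :=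
    Module.Finite.of_restrictScalars_finite R _ _
  refine ⟨?_, Module.natCard_eq_pow_finrank⟩
  have e1 : (K →ₗ[R] (R ⧸ I)) ≃ ((K ⧸ (I • ⊤ : Submodule R K)) →ₗ[R] (R ⧸ I)) :=
    { toFun := fun f => Submodule.liftQ _ f (by
        rw [Submodule.smul_le]
        intro r hr n _
        rw [LinearMap.mem_ker, map_smul, Algebra.smul_def, Ideal.Quotient.algebraMap_eq,
          Ideal.Quotient.eq_zero_iff_mem.2 hr, zero_mul])
      invFun := fun g => g ∘ₗ Submodule.mkQ _
      left_inv := fun f => by ext x; simp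
      right_inv := fun f => by ext x; simp }
  have e2 : ((K ⧸ (I • ⊤ : Submodule R K)) →ₗ[R] (R ⧸ I)) ≃
      ((K ⧸ (I • ⊤ : Submodule R K)) →ₗ[R ⧸ I] (R ⧸ I)) :=
    (LinearMap.extendScalarsOfSurjectiveEquiv Ideal.Quotient.mk_surjective).toEquiv
  rw [Nat.card_congr (e1.trans e2), Module.natCard_eq_pow_finrank (K := R ⧸ I),
    Module.finrank_linearMap, Module.finrank_self, mul_one]

/-- Submodule of `R^n` generated by `r` elements and containing `c R^n`, `c` not nilpotent. -/
lemma rank_bound {R : Type} [CommRing R] {n r : ℕ} (k : Fin r → (Fin n → R)) (c : R)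
    (hc : ¬ IsNilpotent c) (h : ∀ x : Fin n → R, c • x ∈ Submodule.span R (Set.range k)) :
    n ≤ r := by
  have hex : ∃ q : Ideal R, q.IsPrime ∧ c ∉ q := by
    by_contra hcon
    push Not at hcon
    apply hc
    rw [← mem_nilradical, nilradical_eq_sInf, Ideal.mem_sInf]
    intro I hI
    exact hcon I hI
  obtain ⟨q, hq, hcq⟩ := hex
  let Q := FractionRing (R ⧸ q)
  let φ : R →+* Q := (algebraMap (R ⧸ q) Q).comp (Ideal.Quotient.mk q)
  have hφc : φ c ≠ 0 := by
    intro h0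
    apply hcq
    rw [← Ideal.Quotient.eq_zero_iff_mem]
    exact (IsFractionRing.injective (R ⧸ q) Q) (by simpa [φ] using h0)
  let k' : Fin r → (Fin n → Q) := fun i j => φ (k i j)
  have hmem : ∀ x ∈ Submodule.span R (Set.range k),
      (fun j => φ (x j)) ∈ Submodule.span Q (Set.range k') := by
    intro x hx
    induction hx using Submodule.span_induction with
    | mem x hx =>
      obtain ⟨i, rfl⟩ := hx
      exact Submodule.subset_span ⟨i, rfl⟩
    | zero => 
      convert Submodule.zero_mem _
      simp
    | add x y _ _ hx hy => 
      convert Submodule.add_mem _ hx hy using 1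
      ext j; simp
    | smul a x _ hx =>
      convert Submodule.smul_mem _ (φ a) hx using 1
      ext j; simp
  have htop : Submodule.span Q (Set.range k') = ⊤ := by
    rw [eq_top_iff, ← (Pi.basisFun Q (Fin n)).span_eq, Submodule.span_le]
    rintro _ ⟨i, rfl⟩
    have := hmem _ (h (Pi.single i 1))
    have h2 := Submodule.smul_mem _ (φ c)⁻¹ this
    have h3 : (Pi.basisFun Q (Fin n)) i = (φ c)⁻¹ • fun j => φ ((c • Pi.single i 1 : Fin n → R) j) := by
      ext j
      by_cases hij : j = i
      · subst hij
        simp [inv_mul_cancel₀ hφc]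
      · simp [hij]
    rw [h3]
    exact h2
  have := finrank_range_le_card (R := Q) k'
  rw [Set.finrank, htop, finrank_top] at this
  simpa using this

lemma rank_ge {R : Type} [CommRing R] [IsNoetherianRing R] (I : Ideal R) [I.IsMaximal]
    [Finite (R ⧸ I)] (n : ℕ)
    (K : Submodule R (Fin n → R)) (c : R) (hc : c ∈ nonZeroDivisors R)
    (hK : ∀ x : Fin n → R, c • x ∈ K) :
    letI : Field (R ⧸ I) := Ideal.Quotient.field I
    n ≤ Module.finrank (R ⧸ I) (K ⧸ (I • ⊤ : Submodule R K)) := by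
  letI : Field (R ⧸ I) := Ideal.Quotient.field I
  have : Module.Finite (R ⧸ I) (K ⧸ (I • ⊤ : Submodule R K)) :=
    Module.Finite.of_restrictScalars_finite R _ _
  let b := Module.finBasis (R ⧸ I) (K ⧸ (I • ⊤ : Submodule R K))
  set r := Module.finrank (R ⧸ I) (K ⧸ (I • ⊤ : Submodule R K))
  have hsurj := Submodule.mkQ_surjective (I • ⊤ : Submodule R K)
  choose k hk using fun i => hsurj (b i)
  let N : Submodule R K := Submodule.span R (Set.range k)
  have hN : (⊤ : Submodule R K) ≤ N ⊔ I • ⊤ := by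
    intro x _
    have hx : (I • ⊤ : Submodule R K).mkQ x = ∑ i, b.repr (Submodule.mkQ _ x) i • b i :=
      (b.sum_repr _).symm
    choose a ha using fun i => Ideal.Quotient.mk_surjective (b.repr (Submodule.mkQ _ x) i)
    have hx2 : (I • ⊤ : Submodule R K).mkQ (x - ∑ i, a i • k i) = 0 := by
      rw [map_sub, hx, map_sum, sub_eq_zero]
      refine Finset.sum_congr rfl fun i _ => ?_
      rw [map_smul, hk, ← ha i]
      rfl
    have hx3 : x - ∑ i, a i • k i ∈ (I • ⊤ : Submodule R K) := by
      rwa [← Submodule.ker_mkQ (I • ⊤ : Submodule R K), LinearMap.mem_ker]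
    have : x = (∑ i, a i • k i) + (x - ∑ i, a i • k i) := by abel
    rw [this]
    refine Submodule.add_mem_sup (Submodule.sum_mem _ fun i _ => Submodule.smul_mem _ _ 
      (Submodule.subset_span ⟨i, rfl⟩)) hx3
  obtain ⟨s, hs, hsN⟩ := Submodule.exists_sub_one_mem_and_smul_le_of_fg_of_le_sup
    (I := I) (N := N) (N' := ⊤) (P := ⊤) (IsNoetherian.noetherian _) le_rfl hN
  have hs' : ¬ IsNilpotent s := by
    rintro ⟨e, he⟩
    have h1 : Ideal.Quotient.mk I s = 1 := by
      rw [← map_one (Ideal.Quotient.mk I), Ideal.Quotient.eq]; exact hs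
    have h2 : (Ideal.Quotient.mk I s) ^ e = 0 := by rw [← map_pow, he, map_zero]
    rw [h1, one_pow] at h2
    exact one_ne_zero h2
  refine rank_bound (fun i => (k i : Fin n → R)) (s * c) ?_ ?_
  · rintro ⟨e, he⟩
    apply hs'
    refine ⟨e, ?_⟩
    rw [mul_pow] at he
    exact (mul_right_mem_nonZeroDivisors_eq_zero_iff (pow_mem hc e)).1 he
  · intro x
    have h1 : s • (⟨c • x, hK x⟩ : K) ∈ N :=
      hsN (Submodule.smul_mem_pointwise_smul _ s ⊤ trivial)
    have h2 := Submodule.mem_map_of_mem (f := K.subtype) h1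
    rw [Submodule.map_span, ← Set.range_comp] at h2
    simpa [mul_smul, Function.comp_def] using h2

lemma card_hom_congr {R : Type} [CommRing R] (K : Type) {F F' : Type} [AddCommGroup K] [Module R K]
    [AddCommGroup F] [Module R F] [AddCommGroup F'] [Module R F'] (e : F ≃ₗ[R] F') :
    Nat.card (K →ₗ[R] F) = Nat.card (K →ₗ[R] F') :=
  Nat.card_congr
    { toFun := fun f => e.toLinearMap ∘ₗ f
      invFun := fun f => e.symm.toLinearMap ∘ₗ f
      left_inv := fun f => by ext x; simp
      right_inv := fun f => by ext x; simp }

lemma card_hom_free {R : Type} [CommRing R] (n : ℕ) (F : Type) [AddCommGroup F] [Module R F] :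
    Nat.card ((Fin n → R) →ₗ[R] F) = Nat.card F ^ n := by
  rw [← Nat.card_congr ((Pi.basisFun R (Fin n)).constr ℕ).toEquiv, Nat.card_pi]
  simp

lemma rank_eq {R : Type} [CommRing R] [IsNoetherianRing R] (I : Ideal R) [I.IsMaximal]
    [Finite (R ⧸ I)] (n : ℕ)
    (K : Submodule R (Fin n → R)) [Finite ((Fin n → R) ⧸ K)]
    (π : R) (hπ : π ∈ nonZeroDivisors R) (hI : I = Ideal.span {π}) :
    Nat.card (K →ₗ[R] (R ⧸ I)) = Nat.card (R ⧸ I) ^ n := by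
  have key : Nat.card (K ⧸ (I • ⊤ : Submodule R K)) =
      Nat.card ((Fin n → R) ⧸ (I • ⊤ : Submodule R (Fin n → R))) := by
    let f : (Fin n → R) →+ (Fin n → R) := DistribSMul.toAddMonoidHom _ π
    have hf : Function.Injective f := by
      rw [injective_iff_map_eq_zero]
      intro x hx
      ext i
      have := congrFun hx i
      exact (mul_left_mem_nonZeroDivisors_eq_zero_iff hπ).1 this
    let A : AddSubgroup (Fin n → R) := K.toAddSubgroup
    have hA : A.index ≠ 0 := by
      have : Finite ((Fin n → R) ⧸ A) := inferInstanceAs (Finite ((Fin n → R) ⧸ K))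
      exact Nat.card_pos.ne'
    let B : AddSubgroup (Fin n → R) := (⊤ : AddSubgroup _).map f
    let C : AddSubgroup (Fin n → R) := A.map f
    have hCA : C ≤ A := by
      rintro _ ⟨x, hx, rfl⟩
      exact K.smul_mem π hx
    have hCB : C ≤ B := AddSubgroup.map_mono le_top
    have e1 := AddSubgroup.relIndex_mul_index hCA
    have e2 := AddSubgroup.relIndex_mul_index hCB
    have e3 : C.relIndex B = A.index := by
      rw [AddSubgroup.relIndex_map_map_of_injective _ _ hf, AddSubgroup.relIndex_top_right]
    have e4 : C.relIndex A = B.index := by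
      rw [e3, ← e1, mul_comm] at e2
      exact (Nat.eq_of_mul_eq_mul_right (Nat.pos_of_ne_zero hA) e2).symm
    have e5 : B = (I • ⊤ : Submodule R (Fin n → R)).toAddSubgroup := by
      ext x
      rw [hI, Submodule.ideal_span_singleton_smul]
      simp only [Submodule.mem_toAddSubgroup, Submodule.mem_smul_pointwise_iff_exists]
      exact ⟨fun ⟨y, _, h⟩ => ⟨y, trivial, h⟩, fun ⟨y, _, h⟩ => ⟨y, trivial, h⟩⟩
    have e6 : C.addSubgroupOf A = (I • ⊤ : Submodule R K).toAddSubgroup := by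
      ext x
      rw [hI, Submodule.ideal_span_singleton_smul]
      simp only [Submodule.mem_toAddSubgroup, Submodule.mem_smul_pointwise_iff_exists]
      exact ⟨fun ⟨y, hy, h⟩ => ⟨⟨y, hy⟩, trivial, Subtype.ext h⟩,
        fun ⟨y, _, h⟩ => ⟨y, y.2, congrArg Subtype.val h⟩⟩
    have e7 : Nat.card (K ⧸ (I • ⊤ : Submodule R K)) = C.relIndex A := by
      rw [AddSubgroup.relIndex, e6]; rfl
    rw [e7, e4, e5]; rfl
  have h1 := card_hom_residue I K
  have h2 := card_hom_residue I (Fin n → R)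
  rw [h1.1, ← h1.2, key, h2.2, ← h2.1, card_hom_free]

lemma algMap_nzd (p : ℕ) [Fact p.Prime] (P : Polynomial ℤ_[p]) (hP : P.Monic) (z : ℤ_[p])
    (hz : z ≠ 0) :
    algebraMap ℤ_[p] (Polynomial ℤ_[p] ⧸ Ideal.span {P}) z ∈
      nonZeroDivisors (Polynomial ℤ_[p] ⧸ Ideal.span {P}) := by
  have : Module.Free ℤ_[p] (Polynomial ℤ_[p] ⧸ Ideal.span {P}) := hP.free_quotient
  rw [mem_nonZeroDivisors_iff_right]
  intro x hx
  rw [mul_comm, ← Algebra.smul_def] at hx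
  exact (smul_eq_zero.1 hx).resolve_left hz

lemma one_sub_unit (p : ℕ) [Fact p.Prime] (P : Polynomial ℤ_[p]) (hP : P.Monic)
    (c : Polynomial ℤ_[p] ⧸ Ideal.span {P}) : IsUnit (1 - c * (p : Polynomial ℤ_[p] ⧸ Ideal.span {P})) := by
  have : Module.Finite ℤ_[p] (Polynomial ℤ_[p] ⧸ Ideal.span {P}) := hP.finite_quotient
  by_contra hn
  obtain ⟨M, hM, hMem⟩ := exists_max_ideal_of_mem_nonunits hn
  have h1 := Ideal.isMaximal_comap_of_isIntegral_of_isMaximal (R := ℤ_[p]) M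
  have h2 := IsLocalRing.eq_maximalIdeal h1
  have h3 : (p : ℤ_[p]) ∈ M.comap (algebraMap ℤ_[p] (Polynomial ℤ_[p] ⧸ Ideal.span {P})) := by
    rw [h2, PadicInt.maximalIdeal_eq_span_p]
    exact Ideal.mem_span_singleton_self _
  rw [Ideal.mem_comap, map_natCast] at h3
  apply hM.ne_top
  rw [Ideal.eq_top_iff_one]
  have := M.add_mem hMem (M.mul_mem_left c h3)
  simpa using this

lemma map_ker (p : ℕ) [Fact p.Prime] (f : Polynomial ℤ_[p])
    (hf : f.map (PadicInt.toZMod (p := p)) = 0) : ∃ g, f = C (p : ℤ_[p]) * g := by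
  have : C (p : ℤ_[p]) ∣ f := by
    rw [Polynomial.C_dvd_iff_dvd_coeff]
    intro i
    have : PadicInt.toZMod (f.coeff i) = 0 := by rw [← Polynomial.coeff_map, hf, coeff_zero]
    rw [← RingHom.mem_ker, PadicInt.ker_toZMod, PadicInt.maximalIdeal_eq_span_p,
      Ideal.mem_span_singleton] at this
    exact this
  exact this

lemma map_surj (p : ℕ) [Fact p.Prime] :
    Function.Surjective (fun f : Polynomial ℤ_[p] => f.map (PadicInt.toZMod (p := p))) :=
  Polynomial.map_surjective _ (ZMod.ringHom_surjective _)

lemma ker_principal (p : ℕ) [Fact p.Prime] (P : Polynomial ℤ_[p]) (hP : P.Monic)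
    (B W : Polynomial (ZMod p)) (hBW : ¬ B ∣ W)
    (hfac : P.map (PadicInt.toZMod (p := p)) = B * W)
    (θ : (Polynomial ℤ_[p] ⧸ Ideal.span {P}) →+* (Polynomial (ZMod p) ⧸ Ideal.span {B}))
    (hθ : ∀ f, θ (Ideal.Quotient.mk _ f) = Ideal.Quotient.mk _ (f.map (PadicInt.toZMod (p := p))))
    (hmax : (RingHom.ker θ).IsMaximal) :
    ∃ π ∈ nonZeroDivisors (Polynomial ℤ_[p] ⧸ Ideal.span {P}),
      RingHom.ker θ = Ideal.span {π} := by
  let mk := Ideal.Quotient.mk (Ideal.span {P})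
  obtain ⟨Q0, hQ0⟩ := map_surj p B
  obtain ⟨W0, hW0⟩ := map_surj p W
  dsimp only at hQ0 hW0
  obtain ⟨V0, hV0⟩ := map_ker p (P - Q0 * W0) (by
    rw [Polynomial.map_sub, Polynomial.map_mul, hfac, hQ0, hW0, sub_self])
  have hCp : mk (C (p : ℤ_[p])) = (p : Polynomial ℤ_[p] ⧸ Ideal.span {P}) := by
    rw [map_natCast C, map_natCast mk]
  have hPz : mk P = 0 := Ideal.Quotient.eq_zero_iff_mem.2 (Ideal.mem_span_singleton_self _)
  have hqw : mk Q0 * mk W0 = p * (- mk V0) := by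
    have := congrArg mk hV0
    rw [map_sub, map_mul, map_mul, hCp, hPz] at this
    linear_combination -this
  have hθp : θ (p : Polynomial ℤ_[p] ⧸ Ideal.span {P}) = 0 := by
    rw [← hCp, hθ]
    simp
  have hθq : θ (mk Q0) = 0 := by
    rw [hθ, hQ0]
    exact Ideal.Quotient.eq_zero_iff_mem.2 (Ideal.mem_span_singleton_self _)
  have hθw : θ (mk W0) ≠ 0 := by
    rw [hθ, hW0]
    intro h
    exact hBW (Ideal.mem_span_singleton.1 (Ideal.Quotient.eq_zero_iff_mem.1 h))
  obtain ⟨q, v, hq, hv, hqv, hgen⟩ : ∃ q v : Polynomial ℤ_[p] ⧸ Ideal.span {P},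
      θ q = 0 ∧ θ v ≠ 0 ∧ q * mk W0 = p * v ∧ ∃ c, mk Q0 = q + p * c := by
    by_cases hv : θ (mk V0) = 0
    · refine ⟨mk Q0 + p, -mk V0 + mk W0, by rw [map_add, hθq, hθp, add_zero], ?_, ?_, -1, by ring⟩
      · rw [map_add, map_neg, hv]; simpa using hθw
      · linear_combination hqw
    · exact ⟨mk Q0, -mk V0, hθq, by simpa using hv, hqw, 0, by ring⟩
  obtain ⟨c0, hc0⟩ := hgen
  have hker : ∀ r, θ r = 0 → ∃ a b, r = a * q + b * p := by
    intro r hr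
    obtain ⟨f, rfl⟩ := Ideal.Quotient.mk_surjective r
    rw [hθ] at hr
    obtain ⟨g, hg⟩ := Ideal.mem_span_singleton.1 (Ideal.Quotient.eq_zero_iff_mem.1 hr)
    obtain ⟨g0, hg0⟩ := map_surj p g
    dsimp only at hg0
    obtain ⟨h, hh⟩ := map_ker p (f - Q0 * g0) (by
      rw [Polynomial.map_sub, Polynomial.map_mul, hg, hQ0, hg0, sub_self])
    have := congrArg mk hh
    rw [map_sub, map_mul, map_mul, hCp, hc0] at this
    exact ⟨mk g0, c0 * mk g0 + mk h, by linear_combination this⟩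
  obtain ⟨y, hy⟩ : ∃ y, (p : Polynomial ℤ_[p] ⧸ Ideal.span {P}) = y * q := by
    obtain ⟨a, i, hi, hai⟩ := hmax.exists_inv (x := v) hv
    obtain ⟨b, c, rfl⟩ := hker i hi
    obtain ⟨u, hu⟩ := one_sub_unit p P hP c
    refine ⟨↑u⁻¹ * (a * mk W0 + b * p), ?_⟩
    have h1 : (p : Polynomial ℤ_[p] ⧸ Ideal.span {P}) * ↑u = (a * mk W0 + b * p) * q := by
      rw [hu]
      linear_combination (-(p : Polynomial ℤ_[p] ⧸ Ideal.span {P})) * hai - a * hqv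
    rw [mul_assoc, ← h1, mul_left_comm, Units.inv_mul, mul_one]
  refine ⟨q, ?_, ?_⟩
  · have hp := algMap_nzd p P hP p (by exact_mod_cast (Fact.out : p.Prime).ne_zero)
    rw [map_natCast, hy] at hp
    exact (mul_mem_nonZeroDivisors.1 hp).2
  · apply le_antisymm
    · intro r hr
      obtain ⟨a, b, rfl⟩ := hker r hr
      rw [Ideal.mem_span_singleton, hy]
      exact ⟨a + b * y, by ring⟩
    · rw [Ideal.span_singleton_le_iff_mem]
      exact hq

/-- Let `P(t) ∈ ℤ_p[t]` be monic with mod-`p` factorization `P̄ = ∏ P̄_j^{m_j}`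
(`P̄_j` distinct monic irreducible of degree `d_j`), and `G` a finite
`ℤ_p[t]/(P)`-module. Then for each `j`,
`|Ext¹_{ℤ_p[t]/(P)}(G, 𝔽_{p^{d_j}})| = p^{d_j·u} · |Hom_{ℤ_p[t]}(G, 𝔽_{p^{d_j}})|`
for some `u ≥ 0`; in particular `|Hom| ≤ |Ext¹|`, with equality when `m_j = 1`. -/
theorem stmt_15 (p : ℕ) [Fact p.Prime] (P : Polynomial ℤ_[p]) (hP : P.Monic)
    (l : ℕ) (Pbar : Fin l → Polynomial (ZMod p)) (m : Fin l → ℕ)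
    (hm : ∀ j, 1 ≤ m j) (hirr : ∀ j, Irreducible (Pbar j))
    (hmonic : ∀ j, (Pbar j).Monic)
    (hdistinct : ∀ i j, i ≠ j → Pbar i ≠ Pbar j)
    (hfac : P.map (PadicInt.toZMod (p := p)) = ∏ j, (Pbar j) ^ (m j))
    (G : Type) [AddCommGroup G] [Finite G]
    [Module (Polynomial ℤ_[p] ⧸ Ideal.span {P}) G]
    [instF : ∀ j : Fin l,
      Module (Polynomial ℤ_[p] ⧸ Ideal.span {P}) (Polynomial (ZMod p) ⧸ Ideal.span {Pbar j})]
    (hFcompat : ∀ (j : Fin l) (q : Polynomial ℤ_[p])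
        (x : Polynomial (ZMod p) ⧸ Ideal.span {Pbar j}),
      (Ideal.Quotient.mk (Ideal.span {P}) q) • x =
        (Ideal.Quotient.mk (Ideal.span {Pbar j}) (q.map (PadicInt.toZMod (p := p)))) * x) :
    ∀ j : Fin l, ∃ u : ℕ,
      Nat.card ↥(((_root_.Ext (Polynomial ℤ_[p] ⧸ Ideal.span {P})
            (ModuleCat.{0} (Polynomial ℤ_[p] ⧸ Ideal.span {P})) 1).obj
          (Opposite.op (ModuleCat.of _ G))).obj
            (ModuleCat.of _ (Polynomial (ZMod p) ⧸ Ideal.span {Pbar j})))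
        = p ^ ((Pbar j).natDegree * u) *
          Nat.card (G →ₗ[Polynomial ℤ_[p] ⧸ Ideal.span {P}]
            (Polynomial (ZMod p) ⧸ Ideal.span {Pbar j})) ∧
      Nat.card (G →ₗ[Polynomial ℤ_[p] ⧸ Ideal.span {P}]
          (Polynomial (ZMod p) ⧸ Ideal.span {Pbar j}))
        ≤ Nat.card ↥(((_root_.Ext (Polynomial ℤ_[p] ⧸ Ideal.span {P})
            (ModuleCat.{0} (Polynomial ℤ_[p] ⧸ Ideal.span {P})) 1).obj
          (Opposite.op (ModuleCat.of _ G))).obj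
            (ModuleCat.of _ (Polynomial (ZMod p) ⧸ Ideal.span {Pbar j}))) ∧
      (m j = 1 →
        Nat.card ↥(((_root_.Ext (Polynomial ℤ_[p] ⧸ Ideal.span {P})
            (ModuleCat.{0} (Polynomial ℤ_[p] ⧸ Ideal.span {P})) 1).obj
          (Opposite.op (ModuleCat.of _ G))).obj
            (ModuleCat.of _ (Polynomial (ZMod p) ⧸ Ideal.span {Pbar j})))
          = Nat.card (G →ₗ[Polynomial ℤ_[p] ⧸ Ideal.span {P}]
              (Polynomial (ZMod p) ⧸ Ideal.span {Pbar j}))) := by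
  intro j
  let R := Polynomial ℤ_[p] ⧸ Ideal.span {P}
  have hnotdvd : ¬ Pbar j ∣ ∏ i ∈ Finset.univ.erase j, (Pbar i) ^ (m i) := by
    intro h
    rw [(hirr j).prime.dvd_finsetProd_iff] at h
    obtain ⟨i, hi, hd⟩ := h
    have hd' := (hirr j).prime.dvd_of_dvd_pow hd
    exact hdistinct i j (Finset.ne_of_mem_erase hi)
      (Polynomial.eq_of_monic_of_associated (hmonic i) (hmonic j)
        ((hirr j).associated_of_dvd (hirr i) hd').symm)
  have hfacj : P.map (PadicInt.toZMod (p := p)) =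
      (Pbar j) ^ (m j) * ∏ i ∈ Finset.univ.erase j, (Pbar i) ^ (m i) := by
    rw [hfac, Finset.mul_prod_erase _ (fun i => (Pbar i) ^ (m i)) (Finset.mem_univ j)]
  let θ : R →+* (Polynomial (ZMod p) ⧸ Ideal.span {Pbar j}) :=
    Ideal.Quotient.lift (Ideal.span {P})
      ((Ideal.Quotient.mk (Ideal.span {Pbar j})).comp
        (Polynomial.mapRingHom (PadicInt.toZMod (p := p)))) (by
      intro a ha
      obtain ⟨b, rfl⟩ := Ideal.mem_span_singleton.1 ha
      rw [RingHom.comp_apply, Ideal.Quotient.eq_zero_iff_mem, Ideal.mem_span_singleton, map_mul,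
        Polynomial.coe_mapRingHom, hfacj]
      exact Dvd.dvd.mul_right (Dvd.dvd.mul_right
        (dvd_pow_self _ (Nat.one_le_iff_ne_zero.1 (hm j))) _) _)
  have hθ : ∀ f, θ (Ideal.Quotient.mk _ f) =
      Ideal.Quotient.mk _ (f.map (PadicInt.toZMod (p := p))) := fun f => rfl
  have hθs : Function.Surjective θ := by
    intro y
    obtain ⟨g, rfl⟩ := Ideal.Quotient.mk_surjective y
    obtain ⟨f, rfl⟩ := map_surj p g
    exact ⟨Ideal.Quotient.mk _ f, rfl⟩
  have hsm : ∀ (r : R) (x : Polynomial (ZMod p) ⧸ Ideal.span {Pbar j}), r • x = θ r * x := by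
    intro r x
    obtain ⟨f, rfl⟩ := Ideal.Quotient.mk_surjective r
    exact hFcompat j f x
  have hFmax : (Ideal.span {Pbar j}).IsMaximal :=
    PrincipalIdealRing.isMaximal_of_irreducible (hirr j)
  letI : Field (Polynomial (ZMod p) ⧸ Ideal.span {Pbar j}) := Ideal.Quotient.field _
  have hmax : (RingHom.ker θ).IsMaximal := RingHom.ker_isMaximal_of_surjective θ hθs
  have hcardF : Nat.card (Polynomial (ZMod p) ⧸ Ideal.span {Pbar j}) =
      p ^ (Pbar j).natDegree := by
    have : Module.Finite (ZMod p) (Polynomial (ZMod p) ⧸ Ideal.span {Pbar j}) :=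
      (hmonic j).finite_quotient
    rw [Module.natCard_eq_pow_finrank (K := ZMod p), Nat.card_zmod,
      finrank_quotient_span_eq_natDegree]
  have hp0 : 0 < p := (Fact.out : p.Prime).pos
  -- the residue field as an `R`-module
  let tl : R →ₗ[R] (Polynomial (ZMod p) ⧸ Ideal.span {Pbar j}) := LinearMap.toSpanSingleton R _ 1
  have htl : ∀ r, tl r = θ r := fun r => by
    rw [LinearMap.toSpanSingleton_apply, hsm, mul_one]
  have hker : LinearMap.ker tl = RingHom.ker θ := by
    ext r
    rw [LinearMap.mem_ker, RingHom.mem_ker, htl]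
  have htls : Function.Surjective tl := fun y => by
    obtain ⟨r, hr⟩ := hθs y
    exact ⟨r, by rw [htl, hr]⟩
  let eF : (R ⧸ RingHom.ker θ) ≃ₗ[R] (Polynomial (ZMod p) ⧸ Ideal.span {Pbar j}) :=
    (Submodule.quotEquivOfEq _ _ hker.symm).trans (tl.quotKerEquivOfSurjective htls)
  have hcardI : Nat.card (R ⧸ RingHom.ker θ) = p ^ (Pbar j).natDegree := by
    rw [Nat.card_congr eF.toEquiv, hcardF]
  have hfinI : Finite (R ⧸ RingHom.ker θ) :=
    Nat.finite_of_card_ne_zero (by rw [hcardI]; positivity)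
  -- presentation
  have hfinG : Module.Finite R G := Module.Finite.of_finite
  obtain ⟨n, ρ, hρ⟩ := Module.Finite.exists_fin' R G
  have hfinq : Finite ((Fin n → R) ⧸ LinearMap.ker ρ) :=
    Finite.of_equiv G (ρ.quotKerEquivOfSurjective hρ).symm.toEquiv
  have hc : (Nat.card G : R) ∈ nonZeroDivisors R := by
    have := algMap_nzd p P hP (Nat.card G) (by exact_mod_cast Nat.card_pos.ne')
    rwa [map_natCast] at this
  have hK : ∀ x : Fin n → R, (Nat.card G : R) • x ∈ LinearMap.ker ρ := by
    intro x
    rw [LinearMap.mem_ker, map_smul, Nat.cast_smul_eq_nsmul]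
    exact card_nsmul_eq_zero'
  have hext := ext_card (F := Polynomial (ZMod p) ⧸ Ideal.span {Pbar j}) ρ hρ
  rw [card_hom_free, hcardF,
    ← card_hom_congr (LinearMap.ker ρ) eF] at hext
  have hge := rank_ge (RingHom.ker θ) n (LinearMap.ker ρ) _ hc hK
  have hpow := (card_hom_residue (RingHom.ker θ) (LinearMap.ker ρ)).1
  obtain ⟨u, hu⟩ := Nat.exists_eq_add_of_le hge
  rw [hu, hcardI] at hpow
  have hpos : 0 < (p ^ (Pbar j).natDegree) ^ n := by positivity
  refine ⟨u, ?_⟩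
  have main1 : Nat.card ↥(((_root_.Ext (Polynomial ℤ_[p] ⧸ Ideal.span {P})
            (ModuleCat.{0} (Polynomial ℤ_[p] ⧸ Ideal.span {P})) 1).obj
          (Opposite.op (ModuleCat.of _ G))).obj
            (ModuleCat.of _ (Polynomial (ZMod p) ⧸ Ideal.span {Pbar j})))
        = p ^ ((Pbar j).natDegree * u) *
          Nat.card (G →ₗ[Polynomial ℤ_[p] ⧸ Ideal.span {P}]
            (Polynomial (ZMod p) ⧸ Ideal.span {Pbar j})) := by
    apply Nat.eq_of_mul_eq_mul_right hpos
    rw [hpow] at hext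
    refine hext.trans ?_
    rw [pow_add, pow_mul p _ u]
    ring
  refine ⟨main1, ?_, ?_⟩
  · rw [main1]
    exact Nat.le_mul_of_pos_left _ (by positivity)
  · intro hm1
    rw [hm1, pow_one] at hfacj
    obtain ⟨π, hπ, hI⟩ := ker_principal p P hP _ _ hnotdvd hfacj θ hθ hmax
    have hr := rank_eq (RingHom.ker θ) n (LinearMap.ker ρ) π hπ hI
    rw [hcardI] at hr
    apply Nat.eq_of_mul_eq_mul_right hpos
    rw [hr] at hext
    refine hext.trans ?_
    ring
end

section
/- Let R = (ℤ/p^kℤ)[t]/(P(t)) with P monic of degree d, G a finite R-module, and let F ∈ Sur_R(R^n, G) be an R-linear surjection. Let V' = (ℤ/p^kℤ)^n ⊂ R^n (the ℤ/p^kℤ-span of the standard basis). If there exists a matrix X ∈ M_n(ℤ/p^kℤ) with F(X − t̄·I_n) = 0, then F(V') = G. -/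
/-- Let `R = (ℤ/p^kℤ)[t]/(P(t))` with `P` monic of degree `d`, `G` a finite `R`-module,
and `F : R^n → G` an `R`-linear surjection. If there exists `X ∈ M_n(ℤ/p^kℤ)` with
`F(X − t̄·I_n) = 0` (i.e. `F(Xv_j) = t̄·F(v_j)` for all `j`), then `F(V') = G`, where
`V'` is the `ℤ/p^kℤ`-span of the standard basis of `R^n`. -/
theorem stmt_19 (p k n d : ℕ) [Fact p.Prime] (hk : 1 ≤ k)
    (P : Polynomial (ZMod (p ^ k))) (hP : P.Monic) (hd : P.natDegree = d)
    (G : Type*) [AddCommGroup G] [Fintype G]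
    [Module (Polynomial (ZMod (p ^ k)) ⧸ Ideal.span {P}) G]
    (F : (Fin n → Polynomial (ZMod (p ^ k)) ⧸ Ideal.span {P})
          →ₗ[Polynomial (ZMod (p ^ k)) ⧸ Ideal.span {P}] G)
    (hF : Function.Surjective F)
    (X : Matrix (Fin n) (Fin n) (ZMod (p ^ k)))
    (hX : ∀ j : Fin n,
      F (fun i => algebraMap (ZMod (p ^ k)) (Polynomial (ZMod (p ^ k)) ⧸ Ideal.span {P})
            (X i j))
        = (Ideal.Quotient.mk (Ideal.span {P}) Polynomial.X) • F (Pi.single j 1)) :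
    ∀ g : G, ∃ v ∈ Submodule.span (ZMod (p ^ k))
      (Set.range fun i : Fin n =>
        Pi.single i (1 : Polynomial (ZMod (p ^ k)) ⧸ Ideal.span {P})), F v = g := by
  classical
  set R := Polynomial (ZMod (p ^ k)) ⧸ Ideal.span {P} with hR
  set S := Submodule.span (ZMod (p ^ k))
      (Set.range fun i : Fin n => (Pi.single i (1 : R) : Fin n → R)) with hS
  have hs : ∀ (c : ZMod (p ^ k)) (v : Fin n → R), F (c • v) = algebraMap (ZMod (p ^ k)) R c • F v := by
    intro c v
    rw [← map_smul, algebraMap_smul]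
  have ht : ∀ v ∈ S, ∃ w ∈ S, F w = (Ideal.Quotient.mk (Ideal.span {P}) Polynomial.X : R) • F v := by
    intro v hv
    induction hv using Submodule.span_induction with
    | mem x hx =>
      obtain ⟨j, rfl⟩ := hx
      refine ⟨_, ?_, hX j⟩
      have : (fun i => algebraMap (ZMod (p ^ k)) R (X i j))
          = ∑ i, X i j • (Pi.single i (1 : R) : Fin n → R) := by
        ext i
        simp [Finset.sum_apply, Pi.single_apply, Algebra.algebraMap_eq_smul_one]
      rw [this]
      exact Submodule.sum_mem _ fun i _ => Submodule.smul_mem _ _ (Submodule.subset_span ⟨i, rfl⟩)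
    | zero => exact ⟨0, S.zero_mem, by simp⟩
    | add x y _ _ hx hy =>
      obtain ⟨a, ha, ha'⟩ := hx
      obtain ⟨b, hb, hb'⟩ := hy
      exact ⟨a + b, S.add_mem ha hb, by rw [map_add, map_add, smul_add, ha', hb']⟩
    | smul c x _ hx =>
      obtain ⟨a, ha, ha'⟩ := hx
      exact ⟨c • a, S.smul_mem c ha, by rw [hs, hs, ha', smul_comm]⟩
  have hq : ∀ q : Polynomial (ZMod (p ^ k)), ∀ v ∈ S,
      ∃ w ∈ S, F w = (Ideal.Quotient.mk (Ideal.span {P}) q : R) • F v := by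
    intro q
    induction q using Polynomial.induction_on with
    | C a => exact fun v hv => ⟨a • v, S.smul_mem a hv, hs a v⟩
    | add f g hf hg =>
      intro v hv
      obtain ⟨a, ha, ha'⟩ := hf v hv
      obtain ⟨b, hb, hb'⟩ := hg v hv
      exact ⟨a + b, S.add_mem ha hb, by rw [map_add, map_add, add_smul, ha', hb']⟩
    | monomial m a ih =>
      intro v hv
      obtain ⟨w, hw, hw'⟩ := ht v hv
      obtain ⟨u, hu, hu'⟩ := ih w hw
      exact ⟨u, hu, by rw [hu', hw', smul_smul, ← map_mul, pow_succ, mul_assoc]⟩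
  intro g
  obtain ⟨x, rfl⟩ := hF g
  have hx : x = ∑ i, x i • (Pi.single i (1 : R) : Fin n → R) := by
    ext i
    simp [Finset.sum_apply, Pi.single_apply]
  have hc : ∀ i, ∃ w ∈ S, F w = x i • F (Pi.single i 1) := by
    intro i
    obtain ⟨q, hq'⟩ := Ideal.Quotient.mk_surjective (x i)
    rw [← hq']
    exact hq q _ (Submodule.subset_span ⟨i, rfl⟩)
  choose w hw hw' using hc
  refine ⟨∑ i, w i, Submodule.sum_mem _ fun i _ => hw i, ?_⟩
  conv_rhs => rw [hx]
  simp only [map_sum, map_smul, hw']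
end
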